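/- For all integers i, k, n with 2 ≤ i, i ≤ n and i ≤ k − 1, the fundamental group of the unordered configuration space C_k^{i,n} (at any basepoint) is isomorphic to the symmetric group Σ_k on k letters. -/

import Mathlib

noncomputable section

open Module Submodule

/-- Topology on the projectivization (quotient topology). -/
instance (K V : Type*) [DivisionRing K] [AddCommGroup V] [Module K V] [TopologicalSpace V] :
    TopologicalSpace (Projectivization K V) :=
  inferInstanceAs (TopologicalSpace (Quotient (projectivizationSetoid K V)))

/-- The complex projective space `ℂP^n`. -/
abbrev CP (n : ℕ) := Projectivization ℂ (Fin (n + 1) → ℂ)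

/-- `Fconf k i n` is the ordered configuration space `F_k^{i,n}` of `k` pairwise distinct
points of `ℂP^n` whose projective span has dimension `i` (i.e. the span of representative
vectors has linear dimension `i + 1`). -/
def Fconf (k i n : ℕ) : Set (Fin k → CP n) :=
  {x | Function.Injective x ∧
    finrank ℂ (span ℂ (Set.range fun j => (x j).rep)) = i + 1}

/-- The equivalence relation on `F_k^{i,n}` identifying tuples differing by a
permutation of the coordinates. -/
def permSetoid (k i n : ℕ) : Setoid (Fconf k i n) where
  r x y := ∃ σ : Equiv.Perm (Fin k), (y : Fin k → CP n) = (x : Fin k → CP n) ∘ σ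
  iseqv := by
    constructor
    · intro x; exact ⟨Equiv.refl _, rfl⟩
    · rintro x y ⟨σ, h⟩
      refine ⟨σ.symm, ?_⟩
      funext i
      simp [h]
    · rintro x y z ⟨σ, h⟩ ⟨τ, h'⟩
      exact ⟨τ.trans σ, by rw [h', h]; rfl⟩

/-- `Cconf k i n` is the unordered configuration space `C_k^{i,n} = F_k^{i,n}/Σ_k`. -/
def Cconf (k i n : ℕ) : Type := Quotient (permSetoid k i n)

instance (k i n : ℕ) : TopologicalSpace (Cconf k i n) :=
  inferInstanceAs (TopologicalSpace (Quotient (permSetoid k i n)))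

section ConfigurationHelpers

open Topology unitInterval Set

/-- A continuous map that identifies any two paths with the same endpoints up to homotopy. -/
def ContinuousMap.KillsPaths {Y X : Type*} [TopologicalSpace Y] [TopologicalSpace X]
    (f : C(Y, X)) : Prop :=
  ∀ ⦃a b : Y⦄ (p q : Path a b), (p.map f.continuous).Homotopic (q.map f.continuous)

theorem ContinuousMap.KillsPaths.of_homotopic {Y X : Type*} [TopologicalSpace Y]
    [TopologicalSpace X] {f g : C(Y, X)} (h : f.Homotopic g) (hg : g.KillsPaths) :
    f.KillsPaths := by
  obtain ⟨H⟩ := h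
  intro a b p q
  have hp := Path.Homotopic.Quotient.eq.2 (Path.Homotopic.map_trans_evalAt H p)
  have hq := Path.Homotopic.Quotient.eq.2 (Path.Homotopic.map_trans_evalAt H q)
  have hpq := Path.Homotopic.Quotient.eq.2 (hg p q)
  rw [← Path.Homotopic.Quotient.eq]
  simp only [Path.Homotopic.Quotient.mk_trans] at hp hq
  rw [hpq, ← hq] at hp
  have := congrArg (fun r => r.trans (Path.Homotopic.Quotient.mk (H.evalAt b)).symm) hp
  simpa using this

theorem ContinuousMap.killsPaths_comp {Y Z X : Type*} [TopologicalSpace Y] [TopologicalSpace Z]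
    [TopologicalSpace X] [SimplyConnectedSpace Z] (h : C(Z, X)) (f : C(Y, Z)) :
    (h.comp f).KillsPaths := fun _ _ p q =>
  (SimplyConnectedSpace.paths_homotopic (p.map f.continuous) (q.map f.continuous)).map h

/-- If the inclusion of `U` kills paths, then two paths in `U` with the same endpoints are
homotopic in the ambient space. -/
theorem Path.homotopic_of_killsPaths {X : Type*} [TopologicalSpace X] {U : Set X}
    (hU : (ContinuousMap.mk ((↑) : U → X) continuous_subtype_val).KillsPaths)
    {a b : X} (p q : Path a b) (hp : ∀ t, p t ∈ U) (hq : ∀ t, q t ∈ U) : p.Homotopic q := by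
  have ha : a ∈ U := by simpa using hp 0
  have hb : b ∈ U := by simpa using hp 1
  let lift (r : Path a b) (hr : ∀ t, r t ∈ U) : Path (⟨a, ha⟩ : U) ⟨b, hb⟩ :=
    { toFun := fun t => ⟨r t, hr t⟩
      source' := by simp
      target' := by simp }
  exact hU (lift p hp) (lift q hq)

/-- The simple connectedness part of the Seifert-van Kampen theorem. -/
theorem simplyConnectedSpace_of_openCover {X ι : Type*} [TopologicalSpace X] [Nonempty X]
    (U : ι → Set X) (hopen : ∀ α, IsOpen (U α)) (hcover : ∀ x, ∃ α, x ∈ U α)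
    (hconn : ∀ T : Finset ι, T.Nonempty → IsPathConnected (⋂ α ∈ T, U α))
    (hkill : ∀ α, (ContinuousMap.mk ((↑) : U α → X) continuous_subtype_val).KillsPaths) :
    SimplyConnectedSpace X := by
  classical
  have hpair (α β : ι) : IsPathConnected (U α ∩ U β) := by
    simpa using hconn {α, β} (by simp)
  rw [simply_connected_iff_loops_nullhomotopic]
  refine ⟨⟨inferInstance, fun x y => ?_⟩, fun x γ => ?_⟩
  · obtain ⟨α, hα⟩ := hcover x
    obtain ⟨β, hβ⟩ := hcover y
    obtain ⟨p, hpα, hpβ⟩ := (hpair α β).nonempty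
    have hself (δ : ι) : IsPathConnected (U δ) := by simpa using hpair δ δ
    exact ((hself α).joinedIn x hα p hpα).joined.trans ((hself β).joinedIn p hpβ y hβ).joined
  obtain ⟨t, ht0, htm, ⟨N, hN⟩, htU⟩ := exists_monotone_Icc_subset_open_cover_unitInterval
    (c := fun α => γ ⁻¹' U α) (fun α => (hopen α).preimage γ.continuous)
    (fun s _ => mem_iUnion.2 (hcover (γ s)))
  choose α hα using htU
  obtain ⟨p, hp⟩ := (hconn ((Finset.range (N + 1)).image α) (by simp)).nonempty
  have hp' (m : ℕ) (hm : m ≤ N) : p ∈ U (α m) :=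
    mem_iInter₂.1 hp _ (Finset.mem_image_of_mem _ (by simpa using Nat.lt_succ_of_le hm))
  -- two paths from `p` lying in possibly different members of the cover are homotopic
  have hcompare {y : X} {β δ : ι} (q r : Path p y) (hq : ∀ s, q s ∈ U β) (hr : ∀ s, r s ∈ U δ) :
      q.Homotopic r := by
    have h0 : p ∈ U β ∩ U δ := ⟨by simpa using hq 0, by simpa using hr 0⟩
    have h1 : y ∈ U β ∩ U δ := ⟨by simpa using hq 1, by simpa using hr 1⟩
    have hj := (hpair β δ).joinedIn p h0 y h1
    exact (Path.homotopic_of_killsPaths (hkill β) q hj.somePath hq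
        fun s => (hj.somePath_mem s).1).trans
      (Path.homotopic_of_killsPaths (hkill δ) hj.somePath r (fun s => (hj.somePath_mem s).2) hr)
  have hleft (m : ℕ) : γ (t m) ∈ U (α m) := hα m ⟨le_rfl, htm m.le_succ⟩
  have hin (m : ℕ) (hm : m ≤ N) : JoinedIn (U (α m)) p (γ (t m)) := by
    have := hpair (α m) (α m)
    rw [inter_self] at this
    exact this.joinedIn _ (hp' m hm) _ (hleft m)
  have h00 : x = γ (t 0) := by rw [ht0, γ.source]
  have h0 := hin 0 (Nat.zero_le _)
  have key (m : ℕ) (hm : m ≤ N) (β : ι) (q : Path p (γ (t m))) (hq : ∀ s, q s ∈ U β) :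
      (h0.somePath.trans (γ.subpath (t 0) (t m))).Homotopic q := by
    induction m generalizing β with
    | zero =>
      rw [Path.subpath_self]
      exact Path.Homotopic.trans ⟨Path.Homotopy.transRefl _⟩
        (hcompare _ _ h0.somePath_mem hq)
    | succ m ih =>
      have hj := hin m (by omega)
      have h1 := ih (by omega) _ hj.somePath hj.somePath_mem
      have hsub (s) : γ.subpath (t m) (t (m + 1)) s ∈ U (α m) := by
        have : γ.subpath (t m) (t (m + 1)) s ∈ range (γ.subpath (t m) (t (m + 1))) := ⟨s, rfl⟩
        rw [Path.range_subpath_of_le _ _ _ (htm m.le_succ)] at this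
        obtain ⟨s', hs', h⟩ := this
        exact h ▸ hα m hs'
      have h2 : (hj.somePath.trans (γ.subpath (t m) (t (m + 1)))).Homotopic q := by
        refine hcompare (β := α m) _ _ (fun s => ?_) hq
        have : (hj.somePath.trans (γ.subpath (t m) (t (m + 1)))) s ∈
          range (hj.somePath.trans (γ.subpath (t m) (t (m + 1)))) := ⟨s, rfl⟩
        rw [Path.trans_range] at this
        rcases this with ⟨s', h⟩ | ⟨s', h⟩
        · exact h ▸ hj.somePath_mem s'
        · exact h ▸ hsub s'
      have h3 : ((γ.subpath (t 0) (t m)).trans (γ.subpath (t m) (t (m + 1)))).Homotopic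
        (γ.subpath (t 0) (t (m + 1))) := ⟨Path.Homotopy.subpathTransSubpath _ _ _ _⟩
      rw [← Path.Homotopic.Quotient.eq] at h1 h2 h3 ⊢
      simp only [Path.Homotopic.Quotient.mk_trans] at h1 h2 h3 ⊢
      rw [← h3, ← h2, ← h1, Path.Homotopic.Quotient.trans_assoc]
  have hN1 : t N = 1 := hN N le_rfl
  have h10 : γ (t N) = γ (t 0) := by rw [hN1, ht0, γ.source, γ.target]
  have hfin := key N le_rfl (α 0) (h0.somePath.cast rfl h10) h0.somePath_mem
  have hsp : γ.subpath (t 0) (t N) = γ.cast h00.symm (by rw [hN1, γ.target]) := by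
    ext s
    simp [Path.subpath, ht0, hN1]
  rw [hsp] at hfin
  have hfin' := hfin.pathCast (rfl : p = p) (by rw [hN1, γ.target] : x = γ (t N))
  have e : ((h0.somePath.cast rfl h00).trans γ).Homotopic (h0.somePath.cast rfl h00) := hfin'
  rw [← Path.Homotopic.Quotient.eq] at e ⊢
  simp only [Path.Homotopic.Quotient.mk_trans] at e
  have := congrArg (fun r =>
    (Path.Homotopic.Quotient.mk (h0.somePath.cast rfl h00)).symm.trans r) e
  simpa [← Path.Homotopic.Quotient.trans_assoc] using this

/-- A set that misses only finitely many points of every complex line through one of its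
points. -/
def ZOpen {P : Type*} [AddCommGroup P] [Module ℂ P] (S : Set P) : Prop :=
  ∀ v ∈ S, ∀ w : P, {z : ℂ | v + z • w ∉ S}.Finite

namespace ZOpen

variable {P : Type*} [AddCommGroup P] [Module ℂ P]

theorem univ : ZOpen (Set.univ : Set P) := fun v _ w => by simp

theorem inter {S T : Set P} (hS : ZOpen S) (hT : ZOpen T) : ZOpen (S ∩ T) := by
  rintro v ⟨h1, h2⟩ w
  refine ((hS v h1 w).union (hT v h2 w)).subset fun z hz => ?_
  by_contra hcon
  simp only [mem_union, mem_ofPred_eq, not_or, not_not] at hcon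
  exact hz hcon

theorem iInter {ι : Sort*} [Finite ι] {S : ι → Set P} (hS : ∀ a, ZOpen (S a)) :
    ZOpen (⋂ a, S a) := by
  intro v hv w
  refine (Set.finite_iUnion fun a => hS a v (mem_iInter.1 hv a) w).subset fun z hz => ?_
  simpa using hz

theorem inter_nonempty {S T : Set P} (hS : ZOpen S) (hT : ZOpen T) (nS : S.Nonempty)
    (nT : T.Nonempty) : (S ∩ T).Nonempty := by
  obtain ⟨v, hv⟩ := nS
  obtain ⟨w, hw⟩ := nT
  have h1 := hS v hv (w - v)
  have h2 := (hT w hw (v - w)).preimage (f := fun z : ℂ => 1 - z)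
    (fun a _ b _ h => by simpa using h)
  obtain ⟨z, hz⟩ := (h1.union h2).infinite_compl.nonempty
  simp only [mem_compl_iff, mem_union, mem_ofPred_eq, mem_preimage, not_or, not_not] at hz
  refine ⟨_, hz.1, ?_⟩
  convert hz.2 using 1
  module

theorem biInter {ι : Type*} {S : ι → Set P} (hS : ∀ a, ZOpen (S a))
    (nS : ∀ a, (S a).Nonempty) (T : Finset ι) :
    ZOpen (⋂ a ∈ T, S a) ∧ (⋂ a ∈ T, S a).Nonempty := by
  classical
  induction T using Finset.induction_on with
  | empty => exact ⟨by simpa using univ, ⟨0, by simp⟩⟩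
  | insert a T _ ih =>
    rw [Finset.set_biInter_insert]
    exact ⟨(hS a).inter ih.1, (hS a).inter_nonempty ih.1 (nS a) ih.2⟩

theorem isPathConnected [TopologicalSpace P] [ContinuousAdd P] [ContinuousSMul ℂ P]
    {S : Set P} (hS : ZOpen S) (nS : S.Nonempty) : IsPathConnected S := by
  obtain ⟨v, hv⟩ := nS
  refine ⟨v, hv, fun {w} hw => ?_⟩
  have hB := hS v hv (w - v)
  have hpc := hB.countable.isPathConnected_compl_of_one_lt_rank
    (by rw [Complex.rank_real_complex]; norm_num)
  have hj := hpc.joinedIn 0 (by simpa using hv) 1 (by simpa using hw)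
  have := (hj.map_continuousOn (f := fun z : ℂ => v + z • (w - v)) (by fun_prop))
  simp only [zero_smul, add_zero, one_smul, add_sub_cancel] at this
  refine this.mono ?_
  rintro _ ⟨z, hz, rfl⟩
  simpa using hz

end ZOpen

/-- A function whose restriction to every complex line is polynomial. -/
def LinePoly {P : Type*} [AddCommGroup P] [Module ℂ P] (f : P → ℂ) : Prop :=
  ∀ v w : P, ∃ p : Polynomial ℂ, ∀ z : ℂ, f (v + z • w) = p.eval z

namespace LinePoly

variable {P : Type*} [AddCommGroup P] [Module ℂ P]

theorem const (c : ℂ) : LinePoly (fun _ : P => c) := fun _ _ => ⟨Polynomial.C c, by simp⟩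

theorem of_affine {f : P → ℂ} (h : ∀ v w (z : ℂ), f (v + z • w) = f v + z * f w) :
    LinePoly f := fun v w =>
  ⟨Polynomial.C (f v) + Polynomial.C (f w) * Polynomial.X, fun z => by simp [h, mul_comm z]⟩

theorem add {f g : P → ℂ} (hf : LinePoly f) (hg : LinePoly g) :
    LinePoly (fun x => f x + g x) := fun v w => by
  obtain ⟨p, hp⟩ := hf v w
  obtain ⟨q, hq⟩ := hg v w
  exact ⟨p + q, by simp [hp, hq]⟩

theorem mul {f g : P → ℂ} (hf : LinePoly f) (hg : LinePoly g) :
    LinePoly (fun x => f x * g x) := fun v w => by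
  obtain ⟨p, hp⟩ := hf v w
  obtain ⟨q, hq⟩ := hg v w
  exact ⟨p * q, by simp [hp, hq]⟩

theorem sub {f g : P → ℂ} (hf : LinePoly f) (hg : LinePoly g) :
    LinePoly (fun x => f x - g x) := fun v w => by
  obtain ⟨p, hp⟩ := hf v w
  obtain ⟨q, hq⟩ := hg v w
  exact ⟨p - q, by simp [hp, hq]⟩

theorem sum {ι : Type*} (s : Finset ι) {f : ι → P → ℂ} (hf : ∀ a, LinePoly (f a)) :
    LinePoly (fun x => ∑ a ∈ s, f a x) := fun v w => by
  choose p hp using fun a => hf a v w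
  exact ⟨∑ a ∈ s, p a, fun z => by simp [hp, Polynomial.eval_finsetSum]⟩

theorem prod {ι : Type*} (s : Finset ι) {f : ι → P → ℂ} (hf : ∀ a, LinePoly (f a)) :
    LinePoly (fun x => ∏ a ∈ s, f a x) := fun v w => by
  choose p hp using fun a => hf a v w
  exact ⟨∏ a ∈ s, p a, fun z => by simp [hp, Polynomial.eval_prod]⟩

theorem det {m : ℕ} {M : P → Matrix (Fin m) (Fin m) ℂ} (hM : ∀ a b, LinePoly fun x => M x a b) :
    LinePoly (fun x => (M x).det) := by
  simp only [Matrix.det_apply']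
  exact sum _ fun _ => (const _).mul (prod _ fun a => hM _ _)

theorem zOpen {f : P → ℂ} (hf : LinePoly f) : ZOpen {x | f x ≠ 0} := by
  intro v hv w
  obtain ⟨p, hp⟩ := hf v w
  have hp0 : p ≠ 0 := by
    rintro rfl
    apply hv
    simpa using hp 0
  refine (p.roots.toFinset.finite_toSet).subset fun z hz => ?_
  have : p.eval z = 0 := by rw [← hp]; simpa using hz
  simpa [hp0] using this

end LinePoly

/-- The point of projective space spanned by a vector, with a fixed value at `0`. -/
def pt {n : ℕ} (v : Fin (n + 1) → ℂ) : CP n :=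
  open Classical in
  if h : v = 0 then Projectivization.mk ℂ (1 : Fin (n + 1) → ℂ) one_ne_zero
  else Projectivization.mk ℂ v h

section Point

variable {n : ℕ}

theorem pt_of_ne {v : Fin (n + 1) → ℂ} (h : v ≠ 0) : pt v = Projectivization.mk ℂ v h :=
  dif_neg h

theorem pt_rep (x : CP n) : pt x.rep = x := by
  rw [pt_of_ne x.rep_nonzero, Projectivization.mk_rep]

theorem pt_smul {a : ℂ} (ha : a ≠ 0) (v : Fin (n + 1) → ℂ) : pt (a • v) = pt v := by
  by_cases hv : v = 0
  · simp [hv]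
  · rw [pt_of_ne hv, pt_of_ne (smul_ne_zero ha hv), Projectivization.mk_eq_mk_iff']
    exact ⟨a, rfl⟩

theorem exists_smul_eq_of_pt_eq {v w : Fin (n + 1) → ℂ} (hv : v ≠ 0) (hw : w ≠ 0)
    (h : pt v = pt w) : ∃ a : ℂ, a ≠ 0 ∧ v = a • w := by
  rw [pt_of_ne hv, pt_of_ne hw, Projectivization.mk_eq_mk_iff'] at h
  obtain ⟨a, ha⟩ := h
  refine ⟨a, ?_, ha.symm⟩
  rintro rfl
  exact hv (by simpa using ha.symm)

theorem exists_rep_pt {v : Fin (n + 1) → ℂ} (hv : v ≠ 0) :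
    ∃ a : ℂ, a ≠ 0 ∧ (pt v).rep = a • v :=
  exists_smul_eq_of_pt_eq (pt v).rep_nonzero hv (pt_rep _)

theorem isOpenQuotientMap_projectivization_mk :
    IsOpenQuotientMap (fun v : {v : Fin (n + 1) → ℂ // v ≠ 0} => Projectivization.mk ℂ v.1 v.2) := by
  have hq : IsQuotientMap
      (fun v : {v : Fin (n + 1) → ℂ // v ≠ 0} => Projectivization.mk ℂ v.1 v.2) :=
    isQuotientMap_quot_mk
  refine ⟨hq.surjective, hq.continuous, fun U hU => ?_⟩
  rw [← hq.isOpen_preimage]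
  have : (fun v : {v : Fin (n + 1) → ℂ // v ≠ 0} => Projectivization.mk ℂ v.1 v.2) ⁻¹'
      ((fun v : {v : Fin (n + 1) → ℂ // v ≠ 0} => Projectivization.mk ℂ v.1 v.2) '' U) =
      ⋃ a : ℂˣ, (fun v : {v : Fin (n + 1) → ℂ // v ≠ 0} =>
        (⟨a • v.1, smul_ne_zero a.ne_zero v.2⟩ : {v : Fin (n + 1) → ℂ // v ≠ 0})) ⁻¹' U := by
    ext v
    simp only [mem_preimage, mem_image, mem_iUnion]
    constructor
    · rintro ⟨w, hw, h⟩
      rw [Projectivization.mk_eq_mk_iff] at h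
      obtain ⟨a, ha⟩ := h
      refine ⟨a, ?_⟩
      convert hw
    · rintro ⟨a, ha⟩
      refine ⟨_, ha, ?_⟩
      rw [Projectivization.mk_eq_mk_iff]
      exact ⟨a, rfl⟩
  rw [this]
  refine isOpen_iUnion fun a => hU.preimage ?_
  exact Continuous.subtype_mk ((continuous_const_smul (a : ℂ)).comp continuous_subtype_val) _

theorem continuous_pt_comp {Y : Type*} [TopologicalSpace Y] {f : Y → Fin (n + 1) → ℂ}
    (hf : Continuous f) (h : ∀ y, f y ≠ 0) : Continuous fun y => pt (f y) := by
  have := isOpenQuotientMap_projectivization_mk.continuous.comp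
    (hf.subtype_mk h)
  refine this.congr fun y => ?_
  simp [pt_of_ne (h y)]

/-- The representative of a point normalized by a linear functional. -/
def aff (f : Dual ℂ (Fin (n + 1) → ℂ)) (x : CP n) : Fin (n + 1) → ℂ :=
  (f x.rep)⁻¹ • x.rep

theorem aff_pt (f : Dual ℂ (Fin (n + 1) → ℂ)) {v : Fin (n + 1) → ℂ} (hv : v ≠ 0) :
    aff f (pt v) = (f v)⁻¹ • v := by
  obtain ⟨a, ha, h⟩ := exists_rep_pt hv
  rw [aff, h, map_smul, smul_smul, smul_eq_mul, mul_inv, mul_right_comm, inv_mul_cancel₀ ha,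
    one_mul]

theorem pt_aff {f : Dual ℂ (Fin (n + 1) → ℂ)} {x : CP n} (h : f x.rep ≠ 0) :
    pt (aff f x) = x := by
  rw [aff, pt_smul (inv_ne_zero h), pt_rep]

theorem apply_aff {f : Dual ℂ (Fin (n + 1) → ℂ)} {x : CP n} (h : f x.rep ≠ 0) :
    f (aff f x) = 1 := by
  rw [aff, map_smul, smul_eq_mul, inv_mul_cancel₀ h]

theorem aff_ne_zero {f : Dual ℂ (Fin (n + 1) → ℂ)} {x : CP n} (h : f x.rep ≠ 0) :
    aff f x ≠ 0 := smul_ne_zero (inv_ne_zero h) x.rep_nonzero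

theorem continuousAt_aff {f : Dual ℂ (Fin (n + 1) → ℂ)} {x : CP n} (h : f x.rep ≠ 0) :
    ContinuousAt (aff f) x := by
  have hx : x = (fun v : {v : Fin (n + 1) → ℂ // v ≠ 0} => Projectivization.mk ℂ v.1 v.2)
      ⟨x.rep, x.rep_nonzero⟩ := by simp
  rw [hx, ← isOpenQuotientMap_projectivization_mk.continuousAt_comp_iff]
  have : aff f ∘ (fun v : {v : Fin (n + 1) → ℂ // v ≠ 0} => Projectivization.mk ℂ v.1 v.2) =
      fun v => (f v.1)⁻¹ • v.1 := by
    funext v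
    rw [Function.comp_apply, ← pt_of_ne, aff_pt f v.2]
  rw [this]
  have hf : Continuous f := f.continuous_of_finiteDimensional
  have hc : Continuous fun v : {v : Fin (n + 1) → ℂ // v ≠ 0} => f v.1 :=
    hf.comp continuous_subtype_val
  exact (hc.continuousAt.inv₀ h).smul continuous_subtype_val.continuousAt

instance : T2Space (CP n) := by
  rw [t2Space_iff_disjoint_nhds]
  intro x y hxy
  obtain ⟨f, hf⟩ := Module.exists_dual_forall_apply_ne_zero (K := ℂ) ![x.rep, y.rep]
    (by intro i; fin_cases i <;> simp [Projectivization.rep_nonzero])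
  have hx : f x.rep ≠ 0 := hf 0
  have hy : f y.rep ≠ 0 := hf 1
  refine (continuousAt_aff hx).tendsto.disjoint ?_ (continuousAt_aff hy).tendsto
  rw [disjoint_nhds_nhds]
  intro h
  apply hxy
  rw [← pt_aff hx, h, pt_aff hy]

end Point

section Configuration

variable {k i n : ℕ}

theorem span_rep_pt {w : Fin k → Fin (n + 1) → ℂ} (hw : ∀ j, w j ≠ 0) :
    span ℂ (Set.range fun j => (pt (w j)).rep) = span ℂ (Set.range w) := by
  choose a ha h using fun j => exists_rep_pt (hw j)
  simp only [h]
  apply le_antisymm <;> rw [span_le] <;> rintro _ ⟨j, rfl⟩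
  · exact smul_mem _ _ (subset_span ⟨j, rfl⟩)
  · have : w j = (a j)⁻¹ • (a j • w j) := by rw [inv_smul_smul₀ (ha j)]
    rw [this]
    exact smul_mem _ _ (subset_span ⟨j, rfl⟩)

theorem pt_mem_Fconf_iff {w : Fin k → Fin (n + 1) → ℂ} (hw : ∀ j, w j ≠ 0) :
    (fun j => pt (w j)) ∈ Fconf k i n ↔ Function.Injective (fun j => pt (w j)) ∧
      finrank ℂ (span ℂ (Set.range w)) = i + 1 := by
  rw [← span_rep_pt hw]; rfl

/-- Data defining a principal open subset of the configuration space. -/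
structure ChartData (k i n : ℕ) where
  /-- the indices of an independent subfamily -/
  J : Fin (i + 1) → Fin k
  /-- the projection detecting its independence -/
  π : (Fin (n + 1) → ℂ) →ₗ[ℂ] Fin (i + 1) → ℂ
  /-- a functional nonzero on every point -/
  den : Dual ℂ (Fin (n + 1) → ℂ)
  /-- a functional separating the points -/
  num : Dual ℂ (Fin (n + 1) → ℂ)
  /-- the index of a distinguished point -/
  pivot : Fin k
  /-- a functional nonzero on the distinguished point -/
  ht : Dual ℂ (Fin (n + 1) → ℂ)

namespace ChartData

/-- The families of vectors satisfying the nonvanishing conditions of a chart. -/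
def Good (c : ChartData k i n) (w : Fin k → Fin (n + 1) → ℂ) : Prop :=
  (Matrix.of fun a b => c.π (w (c.J a)) b).det ≠ 0 ∧ (∀ j, c.den (w j) ≠ 0) ∧
    (∀ j l, j ≠ l → c.num (w j) * c.den (w l) - c.num (w l) * c.den (w j) ≠ 0) ∧
    c.ht (w c.pivot) ≠ 0

/-- The open set of configurations attached to a chart. -/
def dom (c : ChartData k i n) : Set (Fin k → CP n) := {x | c.Good fun j => (x j).rep}

theorem Good.ne_zero {c : ChartData k i n} {w : Fin k → Fin (n + 1) → ℂ} (h : c.Good w) (j) :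
    w j ≠ 0 := by
  intro h0
  exact h.2.1 j (by rw [h0, map_zero])

theorem Good.smul {c : ChartData k i n} {w : Fin k → Fin (n + 1) → ℂ} (h : c.Good w)
    {a : Fin k → ℂ} (ha : ∀ j, a j ≠ 0) : c.Good fun j => a j • w j := by
  obtain ⟨h1, h2, h3, h4⟩ := h
  refine ⟨?_, fun j => ?_, fun j l hjl => ?_, ?_⟩
  · have : (Matrix.of fun p q => c.π (a (c.J p) • w (c.J p)) q) =
        Matrix.of fun p q => a (c.J p) * (Matrix.of fun a b => c.π (w (c.J a)) b) p q := by
      ext p q; simp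
    rw [this, Matrix.det_mul_column]
    exact mul_ne_zero (Finset.prod_ne_zero_iff.2 fun p _ => ha _) h1
  · simpa [ha j] using h2 j
  · have : c.num (a j • w j) * c.den (a l • w l) - c.num (a l • w l) * c.den (a j • w j) =
        a j * a l * (c.num (w j) * c.den (w l) - c.num (w l) * c.den (w j)) := by
      simp only [map_smul, smul_eq_mul]; ring
    rw [this]
    exact mul_ne_zero (mul_ne_zero (ha j) (ha l)) (h3 j l hjl)
  · simpa [ha] using h4

theorem pt_mem_dom_iff {c : ChartData k i n} {w : Fin k → Fin (n + 1) → ℂ}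
    (hw : ∀ j, w j ≠ 0) : (fun j => pt (w j)) ∈ c.dom ↔ c.Good w := by
  choose a ha h using fun j => exists_rep_pt (hw j)
  simp only [dom, mem_ofPred_eq, h]
  refine ⟨fun hg => ?_, fun hg => hg.smul ha⟩
  have := hg.smul (fun j => inv_ne_zero (ha j))
  simpa only [inv_smul_smul₀ (ha _)] using this

theorem isOpen_dom (c : ChartData k i n) : IsOpen c.dom := by
  have hq := IsOpenQuotientMap.piMap
    (fun _ : Fin k => isOpenQuotientMap_projectivization_mk (n := n))
  rw [← hq.isQuotientMap.isOpen_preimage]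
  have : Pi.map (fun _ : Fin k => (fun v : {v : Fin (n + 1) → ℂ // v ≠ 0} =>
      Projectivization.mk ℂ v.1 v.2)) ⁻¹' c.dom = {w | c.Good fun j => (w j).1} := by
    ext w
    rw [mem_preimage, mem_ofPred_eq, ← pt_mem_dom_iff fun j => (w j).2]
    simp only [pt_of_ne (w _).2]
    rfl
  rw [this]
  have hl : ∀ f : Dual ℂ (Fin (n + 1) → ℂ), ∀ j : Fin k,
      Continuous fun w : Fin k → {v : Fin (n + 1) → ℂ // v ≠ 0} => f (w j).1 := fun f j =>
    f.continuous_of_finiteDimensional.comp (continuous_subtype_val.comp (continuous_apply j))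
  have hπ : ∀ a b, Continuous fun w : Fin k → {v : Fin (n + 1) → ℂ // v ≠ 0} =>
      c.π (w (c.J a)).1 b := fun a b => hl (LinearMap.proj b ∘ₗ c.π) (c.J a)
  simp only [Good, ofPred_and, ofPred_forall]
  refine IsOpen.inter ?_ (IsOpen.inter ?_ (IsOpen.inter ?_ ?_))
  · exact isOpen_ne_fun (Continuous.matrix_det (continuous_matrix hπ)) continuous_const
  · exact isOpen_iInter_of_finite fun j => isOpen_ne_fun (hl _ _) continuous_const
  · refine isOpen_iInter_of_finite fun j => isOpen_iInter_of_finite fun l =>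
      isOpen_iInter_of_finite fun _ => isOpen_ne_fun ?_ continuous_const
    exact ((hl _ _).mul (hl _ _)).sub ((hl _ _).mul (hl _ _))
  · exact isOpen_ne_fun (hl _ _) continuous_const

theorem injective_pt_of_separated (den num : Dual ℂ (Fin (n + 1) → ℂ))
    {w : Fin k → Fin (n + 1) → ℂ} (hw : ∀ j, w j ≠ 0)
    (h : ∀ j l, j ≠ l → num (w j) * den (w l) - num (w l) * den (w j) ≠ 0) :
    Function.Injective fun j => pt (w j) := by
  intro j l hjl
  by_contra hne
  obtain ⟨a, -, ha⟩ := exists_smul_eq_of_pt_eq (hw j) (hw l) hjl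
  apply h j l hne
  rw [ha, map_smul, map_smul, smul_eq_mul, smul_eq_mul]
  ring

theorem Good.linearIndependent {c : ChartData k i n} {w : Fin k → Fin (n + 1) → ℂ}
    (h : c.Good w) : LinearIndependent ℂ (w ∘ c.J) := by
  refine LinearIndependent.of_comp c.π ?_
  exact Matrix.linearIndependent_rows_of_det_ne_zero h.1

theorem Good.pt_mem_Fconf {c : ChartData k i n} {w : Fin k → Fin (n + 1) → ℂ}
    (h : c.Good w) (hfin : finrank ℂ (span ℂ (Set.range w)) ≤ i + 1) :
    (fun j => pt (w j)) ∈ Fconf k i n := by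
  rw [pt_mem_Fconf_iff h.ne_zero]
  refine ⟨injective_pt_of_separated c.den c.num h.ne_zero h.2.2.1, le_antisymm hfin ?_⟩
  have h1 := finrank_span_eq_card h.linearIndependent
  rw [Fintype.card_fin] at h1
  rw [← h1]
  exact Submodule.finrank_mono (span_mono (Set.range_comp_subset_range _ _))

end ChartData

end Configuration

section Pinned

variable {k i n : ℕ}

/-- Configurations some of whose points are prescribed. -/
def pinned (k i n : ℕ) (s : Finset (Fin k)) (ε : Fin k → Fin (n + 1) → ℂ) :
    Set (Fin k → CP n) :=
  {x | x ∈ Fconf k i n ∧ ∀ j ∈ s, x j = pt (ε j)}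

theorem mem_span_of_mem_pinned {s : Finset (Fin k)} {ε : Fin k → Fin (n + 1) → ℂ}
    (hε : ∀ j ∈ s, ε j ≠ 0) {x : Fin k → CP n} (hx : x ∈ pinned k i n s ε) {j : Fin k}
    (hj : j ∈ s) : ε j ∈ span ℂ (Set.range fun j => (x j).rep) := by
  obtain ⟨a, ha, h⟩ := exists_smul_eq_of_pt_eq (hε j hj) (x j).rep_nonzero
    (by rw [pt_rep, hx.2 j hj])
  rw [h]
  exact smul_mem _ _ (subset_span ⟨j, rfl⟩)

/-- The parameter space of families of vectors with `s` prescribed. -/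
abbrev Param (k d n : ℕ) : Type :=
  (Fin d → Fin (n + 1) → ℂ) × (Fin k → Fin d → ℂ) × (Fin k → Fin k → ℂ)

open Classical in
/-- The family of vectors attached to a parameter. -/
def paramVec {d : ℕ} (s : Finset (Fin k)) (ε : Fin k → Fin (n + 1) → ℂ)
    (p : Param k d n) (j : Fin k) : Fin (n + 1) → ℂ :=
  if j ∈ s then ε j else ∑ m, p.2.1 j m • p.1 m + ∑ a ∈ s, p.2.2 j a • ε a

theorem paramVec_of_mem {d : ℕ} {s : Finset (Fin k)} (ε : Fin k → Fin (n + 1) → ℂ)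
    (p : Param k d n) {j : Fin k} (hj : j ∈ s) : paramVec s ε p j = ε j := if_pos hj

theorem continuous_paramVec {d : ℕ} (s : Finset (Fin k)) (ε : Fin k → Fin (n + 1) → ℂ)
    (j : Fin k) : Continuous fun p : Param k d n => paramVec s ε p j := by
  unfold paramVec
  split_ifs <;> fun_prop

theorem linePoly_paramVec {d : ℕ} (s : Finset (Fin k)) (ε : Fin k → Fin (n + 1) → ℂ)
    (f : Dual ℂ (Fin (n + 1) → ℂ)) (j : Fin k) :
    LinePoly fun p : Param k d n => f (paramVec s ε p j) := by
  unfold paramVec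
  split_ifs
  · exact LinePoly.const _
  · simp only [map_add, map_sum, map_smul, smul_eq_mul]
    refine LinePoly.add (LinePoly.sum _ fun m => LinePoly.mul ?_ ?_)
      (LinePoly.sum _ fun a => LinePoly.mul ?_ (LinePoly.const _))
    · exact LinePoly.of_affine fun v w z => by simp
    · exact LinePoly.of_affine fun v w z => by simp
    · exact LinePoly.of_affine fun v w z => by simp

theorem zOpen_good {d : ℕ} (s : Finset (Fin k)) (ε : Fin k → Fin (n + 1) → ℂ)
    (c : ChartData k i n) : ZOpen {p : Param k d n | c.Good (paramVec s ε p)} := by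
  simp only [ChartData.Good, ofPred_and, ofPred_forall]
  have hl := linePoly_paramVec (d := d) s ε
  refine ZOpen.inter ?_ (ZOpen.inter ?_ (ZOpen.inter ?_ ?_))
  · refine (LinePoly.det fun a b => ?_).zOpen
    exact hl (LinearMap.proj b ∘ₗ c.π) (c.J a)
  · exact ZOpen.iInter fun j => (hl _ _).zOpen
  · exact ZOpen.iInter fun j => ZOpen.iInter fun l => ZOpen.iInter fun _ =>
      (((hl _ _).mul (hl _ _)).sub ((hl _ _).mul (hl _ _))).zOpen
  · exact (hl _ _).zOpen

theorem finrank_span_paramVec_le {d : ℕ} (s : Finset (Fin k)) (ε : Fin k → Fin (n + 1) → ℂ)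
    (p : Param k d n) : finrank ℂ (span ℂ (Set.range (paramVec s ε p))) ≤ d + s.card := by
  classical
  have h1 : span ℂ (Set.range (paramVec s ε p)) ≤
      span ℂ (Set.range p.1) ⊔ span ℂ (s.image ε : Set (Fin (n + 1) → ℂ)) := by
    rw [span_le]
    rintro _ ⟨j, rfl⟩
    have hmem : ∀ a ∈ s, ε a ∈ span ℂ (s.image ε : Set (Fin (n + 1) → ℂ)) := fun a ha =>
      subset_span (by simpa using ⟨a, ha, rfl⟩)
    unfold paramVec
    split_ifs with hj
    · exact mem_sup_right (hmem j hj)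
    · exact add_mem (mem_sup_left (sum_mem fun m _ => smul_mem _ _ (subset_span ⟨m, rfl⟩)))
        (mem_sup_right (sum_mem fun a ha => smul_mem _ _ (hmem a ha)))
  refine (Submodule.finrank_mono h1).trans ((Submodule.finrank_add_le_finrank_add_finrank _ _).trans
    (add_le_add ?_ ?_))
  · exact (finrank_range_le_card (R := ℂ) p.1).trans (Fintype.card_fin d).le
  · exact (finrank_span_finset_le_card _).trans Finset.card_image_le

theorem exists_span_sup_eq {W E : Submodule ℂ (Fin (n + 1) → ℂ)} (h : E ≤ W) {d : ℕ}
    (hd : finrank ℂ W = d + finrank ℂ E) :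
    ∃ A : Fin d → Fin (n + 1) → ℂ, W ≤ span ℂ (Set.range A) ⊔ E := by
  obtain ⟨C, hC⟩ := Submodule.exists_isCompl (E.submoduleOf W)
  have h1 := Submodule.finrank_add_eq_of_isCompl hC
  rw [(Submodule.submoduleOfEquivOfLe h).finrank_eq, hd] at h1
  have : Module.Free ℂ C := Module.Free.of_divisionRing ℂ C
  let b := Module.finBasisOfFinrankEq ℂ C (show finrank ℂ C = d by omega)
  refine ⟨fun m => ((b m : W) : Fin (n + 1) → ℂ), fun w hw => ?_⟩
  have h2 : (⟨w, hw⟩ : W) ∈ E.submoduleOf W ⊔ C := by rw [hC.sup_eq_top]; trivial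
  obtain ⟨e, he, c, hc, hec⟩ := mem_sup.1 h2
  have hw' : w = (c : Fin (n + 1) → ℂ) + e := by
    exact (congrArg Subtype.val hec).symm.trans (add_comm _ _)
  rw [hw']
  refine add_mem (mem_sup_left ?_) (mem_sup_right he)
  have h3 := congrArg (fun z : C => ((z : W) : Fin (n + 1) → ℂ)) (b.sum_repr ⟨c, hc⟩)
  simp only at h3
  rw [← h3]
  push_cast
  exact sum_mem fun m _ => smul_mem _ _ (subset_span ⟨m, rfl⟩)

theorem exists_paramVec_eq {s : Finset (Fin k)} {ε : Fin k → Fin (n + 1) → ℂ}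
    (hε : LinearIndepOn ℂ ε (s : Set (Fin k))) {d : ℕ} (hd : i + 1 = d + s.card)
    {x : Fin k → CP n} (hx : x ∈ pinned k i n s ε) :
    ∃ p : Param k d n, (∀ j, paramVec s ε p j ≠ 0) ∧ ∀ j, pt (paramVec s ε p j) = x j := by
  classical
  have hne : ∀ j ∈ s, ε j ≠ 0 := fun j hj => hε.ne_zero hj
  have hE : span ℂ (ε '' s) ≤ span ℂ (Set.range fun j => (x j).rep) := by
    rw [span_le]
    rintro _ ⟨j, hj, rfl⟩
    exact mem_span_of_mem_pinned hne hx hj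
  have hcard : finrank ℂ (span ℂ (ε '' s)) = s.card := by
    rw [image_eq_range]
    simpa using finrank_span_eq_card (R := ℂ) hε
  obtain ⟨A, hA⟩ := exists_span_sup_eq hE (d := d) (by rw [hx.1.2, hcard, hd])
  have hcoef : ∀ j, ∃ (B : Fin d → ℂ) (C : Fin k → ℂ),
      ∑ m, B m • A m + ∑ a ∈ s, C a • ε a = (x j).rep := by
    intro j
    obtain ⟨u, hu, v, hv, huv⟩ := mem_sup.1 (hA (subset_span ⟨j, rfl⟩))
    obtain ⟨B, rfl⟩ := (mem_span_range_iff_exists_fun ℂ).1 hu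
    obtain ⟨C, rfl⟩ := (mem_span_image_finset_iff_exists_fun' ℂ).1 hv
    exact ⟨B, C, huv⟩
  choose B C hBC using hcoef
  refine ⟨(A, B, C), fun j => ?_, fun j => ?_⟩ <;> by_cases hj : j ∈ s
  · rw [paramVec_of_mem ε _ hj]; exact hne j hj
  · rw [paramVec, if_neg hj, hBC]; exact (x j).rep_nonzero
  · rw [paramVec_of_mem ε _ hj, hx.2 j hj]
  · rw [paramVec, if_neg hj, hBC, pt_rep]

theorem isPathConnected_pinned_inter {s : Finset (Fin k)} {ε : Fin k → Fin (n + 1) → ℂ}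
    (hε : LinearIndepOn ℂ ε (s : Set (Fin k))) (hs : s.card ≤ i + 1) {ι : Type*}
    (c : ι → ChartData k i n) (hc : ∀ α, (pinned k i n s ε ∩ (c α).dom).Nonempty)
    (T : Finset ι) (hT : T.Nonempty) :
    IsPathConnected (pinned k i n s ε ∩ ⋂ α ∈ T, (c α).dom) := by
  obtain ⟨d, hd⟩ := Nat.exists_eq_add_of_le' hs
  let S : ι → Set (Param k d n) := fun α => {p | (c α).Good (paramVec s ε p)}
  have hS : ∀ α, (S α).Nonempty := by
    intro α
    obtain ⟨x, hx, hxc⟩ := hc α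
    obtain ⟨p, hp0, hp⟩ := exists_paramVec_eq hε hd hx
    refine ⟨p, (ChartData.pt_mem_dom_iff hp0).1 ?_⟩
    simpa only [hp] using hxc
  obtain ⟨h1, h2⟩ := ZOpen.biInter (S := S) (fun α => zOpen_good s ε (c α)) hS T
  obtain ⟨α₀, hα₀⟩ := hT
  have hgood : ∀ p ∈ ⋂ α ∈ T, S α, ∀ α ∈ T, (c α).Good (paramVec s ε p) := fun p hp α hα =>
    mem_iInter₂.1 hp α hα
  have key : pinned k i n s ε ∩ ⋂ α ∈ T, (c α).dom =
      (fun (p : Param k d n) j => pt (paramVec s ε p j)) '' ⋂ α ∈ T, S α := by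
    ext x
    constructor
    · rintro ⟨hx, hxc⟩
      obtain ⟨p, hp0, hp⟩ := exists_paramVec_eq hε hd hx
      refine ⟨p, mem_iInter₂.2 fun α hα => (ChartData.pt_mem_dom_iff hp0).1 ?_, funext hp⟩
      simpa only [hp] using mem_iInter₂.1 hxc α hα
    · rintro ⟨p, hp, rfl⟩
      have hg := hgood p hp
      refine ⟨⟨(hg α₀ hα₀).pt_mem_Fconf ?_, fun j hj => ?_⟩, mem_iInter₂.2 fun α hα => ?_⟩
      · rw [hd]; exact finrank_span_paramVec_le s ε p
      · simp only [paramVec_of_mem ε p hj]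
      · exact (ChartData.pt_mem_dom_iff (hg α hα).ne_zero).2 (hg α hα)
  rw [key]
  refine (h1.isPathConnected h2).image' ?_
  rw [continuousOn_iff_continuous_domRestrict]
  refine continuous_pi fun j => ?_
  exact continuous_pt_comp ((continuous_paramVec s ε j).comp continuous_subtype_val)
    fun p => (hgood p.1 p.2 α₀ hα₀).ne_zero j

end Pinned

section Cover

variable {k i n : ℕ}

theorem exists_chartData {x : Fin k → CP n} (hx : x ∈ Fconf k i n) (pivot : Fin k)
    (ht : Dual ℂ (Fin (n + 1) → ℂ)) (h : ht (x pivot).rep ≠ 0) :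
    ∃ c : ChartData k i n, c.pivot = pivot ∧ c.ht = ht ∧ x ∈ c.dom := by
  obtain ⟨hinj, hrank⟩ := hx
  obtain ⟨f, hfr, hf⟩ : ∃ f : Fin (i + 1) → Fin (n + 1) → ℂ,
      (∀ a, f a ∈ Set.range fun j => (x j).rep) ∧ LinearIndependent ℂ f := by
    obtain ⟨f, hfr, -, hf⟩ := exists_fun_fin_finrank_span_eq ℂ (Set.range fun j => (x j).rep)
    exact ⟨f ∘ Fin.cast hrank.symm, fun a => hfr _, hf.comp _ (Fin.cast_injective _)⟩
  choose J hJ using hfr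
  obtain ⟨π, hπ⟩ := (Fintype.linearCombination ℂ f).exists_leftInverse_of_injective
    (LinearMap.ker_eq_bot.2 (hf.fintypeLinearCombination_injective))
  obtain ⟨den, hden⟩ := exists_dual_forall_apply_ne_zero (K := ℂ) (fun j => (x j).rep)
    fun j => (x j).rep_nonzero
  obtain ⟨num, hnum⟩ := exists_dual_forall_apply_ne_zero (K := ℂ)
    (fun p : {p : Fin k × Fin k // p.1 ≠ p.2} =>
      den (x p.1.2).rep • (x p.1.1).rep - den (x p.1.1).rep • (x p.1.2).rep) (by
    rintro ⟨⟨j, l⟩, hjl⟩ h0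
    rw [sub_eq_zero] at h0
    apply hjl
    apply hinj
    have := congrArg pt h0
    rwa [pt_smul (hden _), pt_smul (hden _), pt_rep, pt_rep] at this)
  refine ⟨⟨J, π, den, num, pivot, ht⟩, rfl, rfl, ?_, hden, fun j l hjl => ?_, h⟩
  · have : (Matrix.of fun a b => π (x (J a)).rep b) = 1 := by
      ext a b
      have h1 := LinearMap.congr_fun hπ (Pi.single a 1)
      simp only [LinearMap.comp_apply, Fintype.linearCombination_apply_single, one_smul,
        LinearMap.id_apply] at h1
      simp only [hJ] at *
      rw [Matrix.of_apply, h1, Matrix.one_apply, Pi.single_apply]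
      simp [eq_comm]
    simp only [this, Matrix.det_one]
    exact one_ne_zero
  · have := hnum ⟨(j, l), hjl⟩
    simp only [map_sub, map_smul, smul_eq_mul] at this
    simpa only [mul_comm] using this

/-- The inclusion of a chart domain in the space of pinned configurations. -/
def chartInclusion (s : Finset (Fin k)) (ε : Fin k → Fin (n + 1) → ℂ) (c : ChartData k i n) :
    C((Subtype.val ⁻¹' c.dom : Set (pinned k i n s ε)), pinned k i n s ε) :=
  ⟨Subtype.val, continuous_subtype_val⟩

theorem simplyConnectedSpace_pinned_of_charts {s : Finset (Fin k)}
    {ε : Fin k → Fin (n + 1) → ℂ} (hε : LinearIndepOn ℂ ε (s : Set (Fin k)))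
    (hs : s.card ≤ i + 1) (hne : (pinned k i n s ε).Nonempty) (Q : ChartData k i n → Prop)
    (hcover : ∀ x ∈ pinned k i n s ε, ∃ c, Q c ∧ x ∈ c.dom)
    (hkill : ∀ c, Q c → (pinned k i n s ε ∩ c.dom).Nonempty → (chartInclusion s ε c).KillsPaths) :
    SimplyConnectedSpace (pinned k i n s ε) := by
  have : Nonempty (pinned k i n s ε) := hne.to_subtype
  refine simplyConnectedSpace_of_openCover
    (ι := {c : ChartData k i n // Q c ∧ (pinned k i n s ε ∩ c.dom).Nonempty})
    (fun c => Subtype.val ⁻¹' c.1.dom) (fun c => c.1.isOpen_dom.preimage continuous_subtype_val)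
    (fun x => ?_) (fun T hT => ?_) fun c => hkill c.1 c.2.1 c.2.2
  · obtain ⟨c, hc, hxc⟩ := hcover x.1 x.2
    exact ⟨⟨c, hc, x.1, x.2, hxc⟩, hxc⟩
  · rw [IsInducing.subtypeVal.isPathConnected_iff]
    convert isPathConnected_pinned_inter hε hs (fun c : {c : ChartData k i n //
      Q c ∧ (pinned k i n s ε ∩ c.dom).Nonempty} => c.1) (fun c => c.2.2) T hT using 1
    rw [← preimage_iInter₂, Subtype.image_preimage_coe]

theorem homotopic_of_vectors {Y : Type*} [TopologicalSpace Y] {X : Set (Fin k → CP n)}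
    (w : I → Y → Fin k → Fin (n + 1) → ℂ)
    (hw : ∀ j, Continuous fun p : I × Y => w p.1 p.2 j) (hne : ∀ t y j, w t y j ≠ 0)
    (hmem : ∀ t y, (fun j => pt (w t y j)) ∈ X) {f g : C(Y, X)}
    (hf : ∀ y j, (f y).1 j = pt (w 0 y j)) (hg : ∀ y j, (g y).1 j = pt (w 1 y j)) :
    f.Homotopic g :=
  ⟨{ toFun := fun p => ⟨fun j => pt (w p.1 p.2 j), hmem _ _⟩
     continuous_toFun := Continuous.subtype_mk
        (continuous_pi fun j => continuous_pt_comp (hw j) fun _ => hne _ _ _) _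
     map_zero_left := fun y => Subtype.ext (funext fun j => (hf y j).symm)
     map_one_left := fun y => Subtype.ext (funext fun j => (hg y j).symm) }⟩

theorem continuous_aff_chart {s : Finset (Fin k)} {ε : Fin k → Fin (n + 1) → ℂ}
    (c : ChartData k i n) (j : Fin k) :
    Continuous fun q : (Subtype.val ⁻¹' c.dom : Set (pinned k i n s ε)) =>
      aff c.den (q.1.1 j) := by
  rw [continuous_iff_continuousAt]
  intro q
  have hq : c.Good fun j => (q.1.1 j).rep := q.2
  refine (continuousAt_aff (hq.2.1 j)).comp (f := fun q : (Subtype.val ⁻¹' c.dom :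
    Set (pinned k i n s ε)) => q.1.1 j) ?_
  exact ((continuous_apply j).comp
    (continuous_subtype_val.comp continuous_subtype_val)).continuousAt

theorem map_mem_Fconf (f : (Fin (n + 1) → ℂ) →ₗ[ℂ] Fin (n + 1) → ℂ)
    (hf : Function.Injective f) {w : Fin k → Fin (n + 1) → ℂ} (hw : ∀ j, w j ≠ 0)
    (h : (fun j => pt (w j)) ∈ Fconf k i n) : (fun j => pt (f (w j))) ∈ Fconf k i n := by
  have hw' : ∀ j, f (w j) ≠ 0 := fun j => by simpa using hf.ne (hw j)
  rw [pt_mem_Fconf_iff hw] at h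
  rw [pt_mem_Fconf_iff hw']
  refine ⟨fun j l hjl => h.1 ?_, ?_⟩
  · obtain ⟨a, ha, hjl⟩ := exists_smul_eq_of_pt_eq (hw' j) (hw' l) hjl
    rw [← map_smul] at hjl
    exact (congrArg pt (hf hjl)).trans (pt_smul ha _)
  · have : Set.range (fun j => f (w j)) = f '' Set.range w := by
      rw [← Set.range_comp]; rfl
    rw [this, span_image, ← (Submodule.equivMapOfInjective f hf _).finrank_eq, h.2]

theorem chartInclusion_killsPaths_of_insert {s : Finset (Fin k)} {ε : Fin k → Fin (n + 1) → ℂ}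
    {c : ChartData k i n} (hpivot : c.pivot ∉ s) (hε : ∀ j ∈ s, ε j ≠ 0)
    (hht : ∀ j ∈ s, c.ht (ε j) = 0) {e : Fin (n + 1) → ℂ} (he : c.ht e = 1)
    (hne : (pinned k i n s ε ∩ c.dom).Nonempty)
    (hsc : (pinned k i n (insert c.pivot s) (Function.update ε c.pivot e)).Nonempty →
      SimplyConnectedSpace (pinned k i n (insert c.pivot s) (Function.update ε c.pivot e))) :
    (chartInclusion s ε c).KillsPaths := by
  have hgood : ∀ q : (Subtype.val ⁻¹' c.dom : Set (pinned k i n s ε)),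
      c.Good fun j => (q.1.1 j).rep := fun q => q.2
  let y (q : (Subtype.val ⁻¹' c.dom : Set (pinned k i n s ε))) (j : Fin k) :=
    aff c.den (q.1.1 j)
  have hy0 : ∀ q j, y q j ≠ 0 := fun q j => aff_ne_zero ((hgood q).2.1 j)
  have hypt : ∀ q j, pt (y q j) = q.1.1 j := fun q j => pt_aff ((hgood q).2.1 j)
  have hyht : ∀ q, c.ht (y q c.pivot) ≠ 0 := fun q => by
    have h1 : c.Good (y q) := by
      rw [← ChartData.pt_mem_dom_iff (hy0 q)]
      simp only [hypt]
      exact q.2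
    exact h1.2.2.2
  have hys : ∀ q, ∀ j ∈ s, c.ht (y q j) = 0 := fun q j hj => by
    obtain ⟨a, -, ha⟩ := exists_smul_eq_of_pt_eq (hy0 q j) (hε j hj)
      (by rw [hypt, q.1.2.2 j hj])
    rw [ha, map_smul, hht j hj, smul_zero]
  have hyc : ∀ j, Continuous fun q => y q j := continuous_aff_chart c
  let t (q : (Subtype.val ⁻¹' c.dom : Set (pinned k i n s ε))) : Fin (n + 1) → ℂ :=
    (c.ht (y q c.pivot))⁻¹ • y q c.pivot - e
  have hhtc : Continuous c.ht := c.ht.continuous_of_finiteDimensional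
  have htc : Continuous t :=
    (((hhtc.comp (hyc _)).inv₀ hyht).smul (hyc _)).sub continuous_const
  have ht0 : ∀ q, c.ht (t q) = 0 := fun q => by
    simp only [t, map_sub, map_smul, smul_eq_mul, he, inv_mul_cancel₀ (hyht q), sub_self]
  let F (τ : I) (q : (Subtype.val ⁻¹' c.dom : Set (pinned k i n s ε))) :
      (Fin (n + 1) → ℂ) →ₗ[ℂ] Fin (n + 1) → ℂ :=
    LinearMap.id - c.ht.smulRight (((τ : ℝ) : ℂ) • t q)
  have hFa : ∀ τ q v, F τ q v = v - c.ht v • ((τ : ℝ) : ℂ) • t q := fun τ q v => rfl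
  have hF : ∀ τ q, Function.Injective (F τ q) := fun τ q => by
    rw [injective_iff_map_eq_zero]
    intro v hv
    rw [hFa] at hv
    have h1 := congrArg c.ht hv
    simp only [map_sub, map_smul, ht0, smul_zero, sub_zero, map_zero] at h1
    simpa [h1] using hv
  have hF0 : ∀ τ q j, F τ q (y q j) ≠ 0 := fun τ q j => by simpa using (hF τ q).ne (hy0 q j)
  have hFmem : ∀ τ q, (fun j => pt (F τ q (y q j))) ∈ pinned k i n s ε := fun τ q => by
    refine ⟨map_mem_Fconf _ (hF τ q) (hy0 q) ?_, fun j hj => ?_⟩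
    · simp only [hypt]
      exact q.1.2.1
    · simp only [hFa, hys q j hj, zero_smul, sub_zero, hypt]
      exact q.1.2.2 j hj
  have hFmem1 : ∀ q, (fun j => pt (F 1 q (y q j))) ∈
      pinned k i n (insert c.pivot s) (Function.update ε c.pivot e) := fun q => by
    refine ⟨(hFmem 1 q).1, fun j hj => ?_⟩
    rcases Finset.mem_insert.1 hj with rfl | hj
    · have : F 1 q (y q c.pivot) = c.ht (y q c.pivot) • e := by
        rw [hFa]
        simp only [t, Icc.coe_one, Complex.ofReal_one, one_smul, smul_sub,
          smul_inv_smul₀ (hyht q), sub_sub_cancel]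
      simp only [this, Function.update_self, pt_smul (hyht q)]
    · rw [Function.update_of_ne (by rintro rfl; exact hpivot hj)]
      exact (hFmem 1 q).2 j hj
  have hcont : ∀ j, Continuous fun p : I × (Subtype.val ⁻¹' c.dom : Set (pinned k i n s ε)) =>
      F p.1 p.2 (y p.2 j) := fun j => by
    simp only [hFa]
    have h1 := (hyc j).comp (continuous_snd (X := I))
    have h2 := htc.comp (continuous_snd (X := I))
    have h3 : Continuous fun p : I × (Subtype.val ⁻¹' c.dom : Set (pinned k i n s ε)) =>
      ((p.1 : ℝ) : ℂ) := Complex.continuous_ofReal.comp (continuous_subtype_val.comp continuous_fst)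
    exact h1.sub ((hhtc.comp h1).smul (h3.smul h2))
  have : SimplyConnectedSpace
      (pinned k i n (insert c.pivot s) (Function.update ε c.pivot e)) := by
    obtain ⟨x, hx, hxc⟩ := hne
    exact hsc ⟨_, hFmem1 ⟨⟨x, hx⟩, hxc⟩⟩
  let f : C((Subtype.val ⁻¹' c.dom : Set (pinned k i n s ε)),
      pinned k i n (insert c.pivot s) (Function.update ε c.pivot e)) :=
    ⟨fun q => ⟨_, hFmem1 q⟩, Continuous.subtype_mk (continuous_pi fun j =>
      continuous_pt_comp ((hcont j).comp (Continuous.prodMk_right 1)) fun q => hF0 1 q j) _⟩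
  have hsub : pinned k i n (insert c.pivot s) (Function.update ε c.pivot e) ⊆ pinned k i n s ε :=
    fun x hx => ⟨hx.1, fun j hj => by
      rw [hx.2 j (Finset.mem_insert_of_mem hj),
        Function.update_of_ne (by rintro rfl; exact hpivot hj)]⟩
  let h : C(pinned k i n (insert c.pivot s) (Function.update ε c.pivot e), pinned k i n s ε) :=
    ⟨Set.inclusion hsub, continuous_inclusion hsub⟩
  refine ContinuousMap.KillsPaths.of_homotopic ?_ (ContinuousMap.killsPaths_comp h f)
  refine homotopic_of_vectors (fun τ q j => F τ q (y q j)) hcont hF0 hFmem (fun q j => ?_)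
    fun q j => rfl
  simp only [hFa, Icc.coe_zero, Complex.ofReal_zero, zero_smul, smul_zero, sub_zero, hypt]
  rfl

end Cover

section FullyPinned

variable {k i n : ℕ}

theorem exists_frame {s : Finset (Fin k)} {ε : Fin k → Fin (n + 1) → ℂ}
    (hε : LinearIndepOn ℂ ε (s : Set (Fin k))) (hs : 2 < s.card)
    {den num : Dual ℂ (Fin (n + 1) → ℂ)}
    (hsep : ∀ j ∈ s, ∀ l ∈ s, j ≠ l → num (ε j) * den (ε l) - num (ε l) * den (ε j) ≠ 0) :
    ∃ u ∈ span ℂ (ε '' s), ∃ v ∈ span ℂ (ε '' s), ∃ d ∈ span ℂ (ε '' s),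
      (den u = 1 ∧ num u = 0) ∧ (den v = 0 ∧ num v = 1) ∧ (den d = 0 ∧ num d = 0) ∧ d ≠ 0 := by
  obtain ⟨a, ha, b, hb, c, hc, hab, hac, hbc⟩ := Finset.two_lt_card.1 hs
  have hD := hsep b hb a ha hab.symm
  set D := num (ε b) * den (ε a) - num (ε a) * den (ε b) with hDdef
  have hspan : ∀ j ∈ s, ε j ∈ span ℂ (ε '' s) := fun j hj => subset_span ⟨j, hj, rfl⟩
  have hab_mem : ∀ p q : ℂ, p • ε a + q • ε b ∈ span ℂ (ε '' {a, b}) := fun p q =>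
    add_mem (smul_mem _ _ (subset_span ⟨a, by simp, rfl⟩))
      (smul_mem _ _ (subset_span ⟨b, by simp, rfl⟩))
  have hle : span ℂ (ε '' {a, b}) ≤ span ℂ (ε '' s) := by
    refine span_mono (image_mono ?_)
    rintro j (rfl | rfl)
    exacts [ha, hb]
  let u := (D⁻¹ * num (ε b)) • ε a + (-(D⁻¹ * num (ε a))) • ε b
  let v := (-(D⁻¹ * den (ε b))) • ε a + (D⁻¹ * den (ε a)) • ε b
  have hu : den u = 1 ∧ num u = 0 := by
    simp only [u, map_add, map_smul, smul_eq_mul]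
    refine ⟨?_, by ring⟩
    rw [← inv_mul_cancel₀ hD]
    simp only [hDdef]
    ring
  have hv : den v = 0 ∧ num v = 1 := by
    simp only [v, map_add, map_smul, smul_eq_mul]
    refine ⟨by ring, ?_⟩
    rw [← inv_mul_cancel₀ hD]
    simp only [hDdef]
    ring
  refine ⟨u, hle (hab_mem _ _), v, hle (hab_mem _ _),
    ε c - (den (ε c) • u + num (ε c) • v),
    sub_mem (hspan c hc) (hle (add_mem (smul_mem _ _ (hab_mem _ _)) (smul_mem _ _ (hab_mem _ _)))),
    hu, hv, ⟨?_, ?_⟩, fun h0 => ?_⟩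
  · simp [hu, hv]
  · simp [hu, hv]
  · rw [sub_eq_zero] at h0
    have hind : LinearIndepOn ℂ ε (insert c ({a, b} : Set (Fin k))) := by
      refine hε.mono ?_
      rintro j (rfl | rfl | rfl)
      exacts [hc, ha, hb]
    rw [linearIndepOn_insert (by simp [hac.symm, hbc.symm])] at hind
    apply hind.2
    rw [h0]
    exact add_mem (smul_mem _ _ (hab_mem _ _)) (smul_mem _ _ (hab_mem _ _))

theorem exists_coefficients (s : Finset (Fin k)) (ε : Fin k → Fin (n + 1) → ℂ)
    {den num : Dual ℂ (Fin (n + 1) → ℂ)} {u v d : Fin (n + 1) → ℂ} (hu : den u = 1 ∧ num u = 0)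
    (hv : den v = 0 ∧ num v = 1) (hd : den d = 0 ∧ num d = 0) (hd0 : d ≠ 0) :
    ∃ κ : Fin k → ℂ, Function.Injective κ ∧
      ∀ l, ∀ j ∈ s, ∀ z a : ℂ, u + z • v + κ l • d ≠ a • ε j := by
  have hfin : (⋃ j ∈ s, {r : ℂ | ∃ z a : ℂ, u + z • v + r • d = a • ε j}).Finite := by
    refine Set.Finite.biUnion s.finite_toSet fun j _ => Set.Subsingleton.finite ?_
    rintro r ⟨z, a, h⟩ r' ⟨z', a', h'⟩
    have h1 := congrArg den h
    have h2 := congrArg num h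
    have h1' := congrArg den h'
    have h2' := congrArg num h'
    simp only [map_add, map_smul, smul_eq_mul, hu, hv, hd, mul_zero, mul_one, add_zero,
      zero_add] at h1 h2 h1' h2'
    have hden : den (ε j) ≠ 0 := by
      intro h0
      rw [h0, mul_zero] at h1
      exact one_ne_zero h1
    obtain rfl : a = a' := mul_right_cancel₀ hden (h1.symm.trans h1')
    obtain rfl : z = z' := h2.trans h2'.symm
    have := h.trans h'.symm
    exact smul_left_injective ℂ hd0 (add_left_cancel this)
  let g := hfin.infinite_compl.natEmbedding
  refine ⟨fun j => g j, fun j l hjl => Fin.val_injective (g.injective (Subtype.ext hjl)),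
    fun l j hj z a h => ?_⟩
  have := (g l).2
  apply this
  simp only [mem_iUnion]
  exact ⟨j, hj, z, a, h⟩

theorem pt_mem_pinned_of_mem_span {s : Finset (Fin k)} {ε : Fin k → Fin (n + 1) → ℂ}
    (hε : LinearIndepOn ℂ ε (s : Set (Fin k))) (hs : s.card = i + 1)
    {w : Fin k → Fin (n + 1) → ℂ} (hws : ∀ j ∈ s, w j = ε j)
    (hspan : ∀ j, w j ∈ span ℂ (ε '' s)) (hne : ∀ j, w j ≠ 0)
    (hinj : Function.Injective fun j => pt (w j)) :
    (fun j => pt (w j)) ∈ pinned k i n s ε := by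
  refine ⟨(pt_mem_Fconf_iff hne).2 ⟨hinj, ?_⟩, fun j hj => by simp only [hws j hj]⟩
  have h1 : span ℂ (Set.range w) = span ℂ (ε '' s) := by
    apply le_antisymm <;> rw [span_le]
    · rintro _ ⟨j, rfl⟩
      exact hspan j
    · rintro _ ⟨j, hj, rfl⟩
      rw [← hws j hj]
      exact subset_span ⟨j, rfl⟩
  rw [h1, image_eq_range, ← hs]
  simpa using finrank_span_eq_card (R := ℂ) hε

theorem chartInclusion_killsPaths_of_card_eq {s : Finset (Fin k)}
    {ε : Fin k → Fin (n + 1) → ℂ} (hε : LinearIndepOn ℂ ε (s : Set (Fin k)))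
    (hs : s.card = i + 1) (hi : 2 ≤ i) (c : ChartData k i n)
    (hne : (pinned k i n s ε ∩ c.dom).Nonempty) : (chartInclusion s ε c).KillsPaths := by
  classical
  have hε0 : ∀ j ∈ s, ε j ≠ 0 := fun j hj => hε.ne_zero hj
  have hgood : ∀ q : (Subtype.val ⁻¹' c.dom : Set (pinned k i n s ε)),
      c.Good fun j => (q.1.1 j).rep := fun q => q.2
  let y (q : (Subtype.val ⁻¹' c.dom : Set (pinned k i n s ε))) (j : Fin k) :=
    aff c.den (q.1.1 j)
  have hypt : ∀ q j, pt (y q j) = q.1.1 j := fun q j => pt_aff ((hgood q).2.1 j)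
  have hyden : ∀ q j, c.den (y q j) = 1 := fun q j => apply_aff ((hgood q).2.1 j)
  have hyc : ∀ j, Continuous fun q => y q j := continuous_aff_chart c
  let w₀ (q : (Subtype.val ⁻¹' c.dom : Set (pinned k i n s ε))) (j : Fin k) :=
    if j ∈ s then ε j else y q j
  have hw₀ : ∀ q j, pt (w₀ q j) = q.1.1 j := fun q j => by
    by_cases hj : j ∈ s
    · simp only [w₀, if_pos hj, q.1.2.2 j hj]
    · simp only [w₀, if_neg hj, hypt]
  have hw₀g : ∀ q, c.Good (w₀ q) := fun q => by
    rw [← ChartData.pt_mem_dom_iff]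
    · simp only [hw₀]
      exact q.2
    · intro j
      by_cases hj : j ∈ s
      · simp only [w₀, if_pos hj]
        exact hε0 j hj
      · simp only [w₀, if_neg hj]
        exact aff_ne_zero ((hgood q).2.1 j)
  obtain ⟨x₀, hx₀, hx₀c⟩ := hne
  let q₀ : (Subtype.val ⁻¹' c.dom : Set (pinned k i n s ε)) := ⟨⟨x₀, hx₀⟩, hx₀c⟩
  have hεden : ∀ j ∈ s, c.den (ε j) ≠ 0 := fun j hj => by
    simpa only [w₀, if_pos hj] using (hw₀g q₀).2.1 j
  have hsep : ∀ j ∈ s, ∀ l ∈ s, j ≠ l →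
      c.num (ε j) * c.den (ε l) - c.num (ε l) * c.den (ε j) ≠ 0 := fun j hj l hl hjl => by
    simpa only [w₀, if_pos hj, if_pos hl] using (hw₀g q₀).2.2.1 j l hjl
  obtain ⟨u, humem, v, hvmem, d, hdmem, hu, hv, hd, hd0⟩ := exists_frame hε (by omega) hsep
  obtain ⟨κ, hκ, hκε⟩ := exists_coefficients s ε hu hv hd hd0
  have hymem : ∀ q j, y q j ∈ span ℂ (ε '' s) := fun q j => by
    have h1 : span ℂ (ε '' s) = span ℂ (Set.range fun j => (q.1.1 j).rep) := by
      refine Submodule.eq_of_le_of_finrank_eq ?_ ?_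
      · rw [span_le]
        rintro _ ⟨j, hj, rfl⟩
        exact mem_span_of_mem_pinned hε0 q.1.2 hj
      · rw [q.1.2.1.2, ← hs, image_eq_range]
        simpa using finrank_span_eq_card (R := ℂ) hε
    rw [h1]
    exact smul_mem _ _ (subset_span ⟨j, rfl⟩)
  have hnumc : Continuous c.num := c.num.continuous_of_finiteDimensional
  have htc : Continuous fun p : I × (Subtype.val ⁻¹' c.dom : Set (pinned k i n s ε)) =>
      ((p.1 : ℝ) : ℂ) := Complex.continuous_ofReal.comp (continuous_subtype_val.comp continuous_fst)
  have hyc' : ∀ j, Continuous fun p : I × (Subtype.val ⁻¹' c.dom : Set (pinned k i n s ε)) =>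
      y p.2 j := fun j => (hyc j).comp continuous_snd
  have hzc : ∀ j, Continuous fun p : I × (Subtype.val ⁻¹' c.dom : Set (pinned k i n s ε)) =>
      c.num (y p.2 j) := fun j => hnumc.comp (hyc' j)
  let w₁ (t : I) (q : (Subtype.val ⁻¹' c.dom : Set (pinned k i n s ε))) (j : Fin k) :=
    if j ∈ s then ε j else (1 - ((t : ℝ) : ℂ)) • y q j +
      ((t : ℝ) : ℂ) • (u + c.num (y q j) • v + κ j • d)
  let w₂ (t : I) (q : (Subtype.val ⁻¹' c.dom : Set (pinned k i n s ε))) (j : Fin k) :=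
    if j ∈ s then ε j else u + ((1 - ((t : ℝ) : ℂ)) * c.num (y q j)) • v + κ j • d
  have hw₁c : ∀ j, Continuous fun p : I × (Subtype.val ⁻¹' c.dom : Set (pinned k i n s ε)) =>
      w₁ p.1 p.2 j := fun j => by
    by_cases hj : j ∈ s
    · simp only [w₁, if_pos hj]
      exact continuous_const
    · simp only [w₁, if_neg hj]
      have h1 := hyc' j
      have h2 := hzc j
      fun_prop
  have hw₂c : ∀ j, Continuous fun p : I × (Subtype.val ⁻¹' c.dom : Set (pinned k i n s ε)) =>
      w₂ p.1 p.2 j := fun j => by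
    by_cases hj : j ∈ s
    · simp only [w₂, if_pos hj]
      exact continuous_const
    · simp only [w₂, if_neg hj]
      have h2 := hzc j
      fun_prop
  have hw₁den : ∀ t q j, c.den (w₁ t q j) = c.den (w₀ q j) := fun t q j => by
    by_cases hj : j ∈ s
    · simp only [w₁, w₀, if_pos hj]
    · simp only [w₁, w₀, if_neg hj, map_add, map_smul, smul_eq_mul, hu, hv, hd, hyden]
      ring
  have hw₁num : ∀ t q j, c.num (w₁ t q j) = c.num (w₀ q j) := fun t q j => by
    by_cases hj : j ∈ s
    · simp only [w₁, w₀, if_pos hj]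
    · simp only [w₁, w₀, if_neg hj, map_add, map_smul, smul_eq_mul, hu, hv, hd]
      ring
  have hw₁ne : ∀ t q j, w₁ t q j ≠ 0 := fun t q j h0 => (hw₀g q).2.1 j (by
    rw [← hw₁den t, h0, map_zero])
  have hw₂den : ∀ t q j, c.den (w₂ t q j) ≠ 0 := fun t q j => by
    by_cases hj : j ∈ s
    · simp only [w₂, if_pos hj]
      exact hεden j hj
    · simp only [w₂, if_neg hj, map_add, map_smul, smul_eq_mul, hu, hv, hd]
      norm_num
  have hw₂ne : ∀ t q j, w₂ t q j ≠ 0 := fun t q j h0 => hw₂den t q j (by rw [h0, map_zero])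
  have hmem₁ : ∀ t q, (fun j => pt (w₁ t q j)) ∈ pinned k i n s ε := fun t q => by
    refine pt_mem_pinned_of_mem_span hε hs (fun j hj => if_pos hj) (fun j => ?_) (hw₁ne t q) ?_
    · by_cases hj : j ∈ s
      · simp only [w₁, if_pos hj]
        exact subset_span ⟨j, hj, rfl⟩
      · simp only [w₁, if_neg hj]
        exact add_mem (smul_mem _ _ (hymem q j)) (smul_mem _ _ (add_mem (add_mem humem
          (smul_mem _ _ hvmem)) (smul_mem _ _ hdmem)))
    · refine ChartData.injective_pt_of_separated c.den c.num (hw₁ne t q) fun j l hjl => ?_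
      simp only [hw₁den, hw₁num]
      exact (hw₀g q).2.2.1 j l hjl
  have hmem₂ : ∀ t q, (fun j => pt (w₂ t q j)) ∈ pinned k i n s ε := fun t q => by
    refine pt_mem_pinned_of_mem_span hε hs (fun j hj => if_pos hj) (fun j => ?_) (hw₂ne t q) ?_
    · by_cases hj : j ∈ s
      · simp only [w₂, if_pos hj]
        exact subset_span ⟨j, hj, rfl⟩
      · simp only [w₂, if_neg hj]
        exact add_mem (add_mem humem (smul_mem _ _ hvmem)) (smul_mem _ _ hdmem)
    · intro j l hjl
      by_cases hj : j ∈ s <;> by_cases hl : l ∈ s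
      · apply q.1.2.1.1
        rw [← hw₀ q, ← hw₀ q]
        simpa only [w₂, w₀, if_pos hj, if_pos hl] using hjl
      · obtain ⟨a, -, ha⟩ := exists_smul_eq_of_pt_eq (hw₂ne t q l) (hw₂ne t q j) hjl.symm
        simp only [w₂, if_neg hl, if_pos hj] at ha
        exact absurd ha (hκε l j hj _ a)
      · obtain ⟨a, -, ha⟩ := exists_smul_eq_of_pt_eq (hw₂ne t q j) (hw₂ne t q l) hjl
        simp only [w₂, if_neg hj, if_pos hl] at ha
        exact absurd ha (hκε j l hl _ a)
      · obtain ⟨a, -, ha⟩ := exists_smul_eq_of_pt_eq (hw₂ne t q j) (hw₂ne t q l) hjl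
        simp only [w₂, if_neg hj, if_neg hl] at ha
        have h1 := congrArg c.den ha
        simp only [map_add, map_smul, smul_eq_mul, hu, hv, hd, mul_zero, add_zero, mul_one] at h1
        rw [← h1, one_smul] at ha
        have h2 := congrArg c.num ha
        simp only [map_add, map_smul, smul_eq_mul, hu, hv, hd, mul_zero, add_zero, mul_one,
          zero_add] at h2
        rw [h2] at ha
        exact hκ (smul_left_injective ℂ hd0 (add_left_cancel ha))
  let g : C((Subtype.val ⁻¹' c.dom : Set (pinned k i n s ε)), pinned k i n s ε) :=
    ⟨fun q => ⟨_, hmem₂ 0 q⟩, Continuous.subtype_mk (continuous_pi fun j =>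
      continuous_pt_comp ((hw₂c j).comp (Continuous.prodMk_right 0)) fun q => hw₂ne 0 q j) _⟩
  have h₁ : (chartInclusion s ε c).Homotopic g := by
    refine homotopic_of_vectors w₁ hw₁c hw₁ne hmem₁ (fun q j => ?_) fun q j => ?_
    · have : w₁ 0 q j = w₀ q j := by simp [w₁, w₀]
      rw [this, hw₀]
      rfl
    · have : w₁ 1 q j = w₂ 0 q j := by simp [w₁, w₂]
      rw [this]
      rfl
  let z : C(Unit, pinned k i n s ε) := ContinuousMap.const _ ⟨_, hmem₂ 1 q₀⟩
  have h₂ : g.Homotopic (z.comp (ContinuousMap.const _ ())) := by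
    refine homotopic_of_vectors w₂ hw₂c hw₂ne hmem₂ (fun q j => rfl) fun q j => ?_
    have : w₂ 1 q j = w₂ 1 q₀ j := by simp [w₂]
    rw [this]
    rfl
  exact .of_homotopic (h₁.trans h₂) (ContinuousMap.killsPaths_comp _ _)

theorem simplyConnectedSpace_pinned (hi : 2 ≤ i) (m : ℕ) :
    ∀ (s : Finset (Fin k)) (ε : Fin k → Fin (n + 1) → ℂ), i + 1 = s.card + m →
      LinearIndepOn ℂ ε (s : Set (Fin k)) → (pinned k i n s ε).Nonempty →
      SimplyConnectedSpace (pinned k i n s ε) := by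
  classical
  induction m with
  | zero =>
    intro s ε hs hε hne
    refine simplyConnectedSpace_pinned_of_charts hε (by omega) hne (fun _ => True)
      (fun x hx => ?_) fun c _ hc => chartInclusion_killsPaths_of_card_eq hε (by omega) hi c hc
    obtain ⟨j, -⟩ := Finset.card_pos.1 (show 0 < s.card by omega)
    obtain ⟨f, hf⟩ := exists_dual_forall_apply_ne_zero (K := ℂ) (fun _ : Unit => (x j).rep)
      fun _ => (x j).rep_nonzero
    obtain ⟨c, -, -, hc⟩ := exists_chartData hx.1 j f (hf ())
    exact ⟨c, trivial, hc⟩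
  | succ m ih =>
    intro s ε hs hε hne
    have hε0 : ∀ j ∈ s, ε j ≠ 0 := fun j hj => hε.ne_zero hj
    refine simplyConnectedSpace_pinned_of_charts hε (by omega) hne
      (fun c => c.pivot ∉ s ∧ ∀ j ∈ s, c.ht (ε j) = 0) (fun x hx => ?_) fun c hQ hc => ?_
    · have h1 : ∃ j, (x j).rep ∉ span ℂ (ε '' s) := by
        by_contra! hcon
        have h2 : span ℂ (Set.range fun j => (x j).rep) ≤ span ℂ (ε '' s) := by
          rw [span_le]
          rintro _ ⟨j, rfl⟩
          exact hcon j
        have h3 := Submodule.finrank_mono h2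
        have h4 : finrank ℂ (span ℂ (ε '' s)) = s.card := by
          rw [image_eq_range]
          simpa using finrank_span_eq_card (R := ℂ) hε
        rw [hx.1.2, h4] at h3
        omega
      obtain ⟨j, hj⟩ := h1
      obtain ⟨f, hfj, hf⟩ := Submodule.exists_le_ker_of_notMem hj
      have hker : ∀ l ∈ s, f (ε l) = 0 := fun l hl => hf (subset_span ⟨l, hl, rfl⟩)
      obtain ⟨c, rfl, rfl, hc⟩ := exists_chartData hx.1 j f hfj
      refine ⟨c, ⟨fun hjs => ?_, hker⟩, hc⟩
      obtain ⟨a, -, ha⟩ := exists_smul_eq_of_pt_eq (x c.pivot).rep_nonzero (hε0 _ hjs)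
        (by rw [pt_rep, hx.2 _ hjs])
      apply hfj
      rw [ha, map_smul, hker _ hjs, smul_zero]
    · obtain ⟨x, hx, hxc⟩ := hc
      have hne0 : c.ht (x c.pivot).rep ≠ 0 := hxc.2.2.2
      have he : c.ht ((c.ht (x c.pivot).rep)⁻¹ • (x c.pivot).rep) = 1 := by
        rw [map_smul, smul_eq_mul, inv_mul_cancel₀ hne0]
      refine chartInclusion_killsPaths_of_insert hQ.1 hε0 hQ.2 he ⟨x, hx, hxc⟩ (ih _ _ ?_ ?_)
      · rw [Finset.card_insert_of_notMem hQ.1]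
        omega
      · rw [Finset.coe_insert, linearIndepOn_insert (by simpa using hQ.1)]
        set e := (c.ht (x c.pivot).rep)⁻¹ • (x c.pivot).rep
        have heq : EqOn (Function.update ε c.pivot e) ε s := fun j hj =>
          Function.update_of_ne (by rintro rfl; exact hQ.1 hj) _ _
        rw [linearIndepOn_congr heq, heq.image_eq, Function.update_self]
        refine ⟨hε, fun hmem => ?_⟩
        have h2 : span ℂ (ε '' s) ≤ LinearMap.ker c.ht := by
          rw [span_le]
          rintro _ ⟨j, hj, rfl⟩
          exact hQ.2 j hj
        have h3 : c.ht e = 0 := h2 hmem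
        rw [he] at h3
        exact one_ne_zero h3

theorem simplyConnectedSpace_Fconf (hi : 2 ≤ i) (hne : (Fconf k i n).Nonempty) :
    SimplyConnectedSpace (Fconf k i n) := by
  have h : pinned k i n ∅ 0 = Fconf k i n := by
    ext x
    simp [pinned]
  rw [← h] at hne ⊢
  exact simplyConnectedSpace_pinned hi (i + 1) ∅ 0 (by simp) (by simp) hne

end FullyPinned

section Permutation

variable {k i n : ℕ}

theorem comp_perm_mem_Fconf {x : Fin k → CP n} (hx : x ∈ Fconf k i n)
    (g : Equiv.Perm (Fin k)) : x ∘ g ∈ Fconf k i n := by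
  refine ⟨hx.1.comp g.injective, ?_⟩
  have : (Set.range fun j => ((x ∘ g) j).rep) = Set.range fun j => (x j).rep :=
    g.surjective.range_comp fun j => (x j).rep
  rw [this, hx.2]

instance : MulAction (Equiv.Perm (Fin k)) (Fconf k i n) where
  smul g x := ⟨x.1 ∘ (g⁻¹ : Equiv.Perm (Fin k)), comp_perm_mem_Fconf x.2 g⁻¹⟩
  one_smul _ := rfl
  mul_smul g h x := Subtype.ext (funext fun j => by
    change x.1 ((g * h)⁻¹ j) = x.1 (h⁻¹ (g⁻¹ j))
    rw [mul_inv_rev, Equiv.Perm.mul_apply])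

theorem isQuotientCoveringMap_mk_Cconf :
    IsQuotientCoveringMap (fun x : Fconf k i n => (Quotient.mk _ x : Cconf k i n))
      (Equiv.Perm (Fin k)) where
  toIsQuotientMap := isQuotientMap_quot_mk
  continuous_const_smul g := continuous_induced_rng.2 (continuous_pi fun j =>
    (continuous_apply (g⁻¹ j)).comp continuous_subtype_val)
  apply_eq_iff_mem_orbit := by
    intro x y
    refine Quotient.eq.trans ?_
    constructor
    · rintro ⟨g, hg⟩
      refine ⟨g, Subtype.ext (funext fun j => ?_)⟩
      change y.1 (g⁻¹ j) = x.1 j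
      rw [hg]
      simp
    · rintro ⟨g, rfl⟩
      refine ⟨g, funext fun j => ?_⟩
      change y.1 j = y.1 (g⁻¹ (g j))
      simp
  disjoint := by
    intro x
    obtain ⟨U, hU, hdisj⟩ := (Set.finite_range x.1).t2_separation
    refine ⟨{y | ∀ j, y.1 j ∈ U (x.1 j)}, ?_, fun g => ?_⟩
    · refine IsOpen.mem_nhds ?_ fun j => (hU _).1
      simp only [ofPred_forall]
      exact isOpen_iInter_of_finite fun j => (hU _).2.preimage
        ((continuous_apply j).comp continuous_subtype_val)
    · rintro ⟨_, ⟨y, hy, rfl⟩, hy'⟩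
      refine Equiv.ext fun j => ?_
      by_contra hne
      have h1 : y.1 j ∈ U (x.1 (g j)) := by
        have h2 : y.1 (g⁻¹ (g j)) ∈ U (x.1 (g j)) := hy' (g j)
        simpa using h2
      exact (hdisj (mem_range_self _) (mem_range_self _) (fun h => hne (x.2.1 h))).le_bot
        ⟨h1, hy j⟩

end Permutation

end ConfigurationHelpers

/-- For `2 ≤ i ≤ n` and `i ≤ k - 1`, the fundamental group of the unordered configuration
space `C_k^{i,n}` is isomorphic to the symmetric group `Σ_k`. -/
theorem pi1_Cconf_eq_symm (i k n : ℕ) (hi : 2 ≤ i) (hin : i ≤ n) (hik : i ≤ k - 1)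
    (x : Cconf k i n) :
    Nonempty (FundamentalGroup (Cconf k i n) x ≃* Equiv.Perm (Fin k)) := by
  obtain ⟨e, he⟩ := Quotient.exists_rep x
  have := simplyConnectedSpace_Fconf hi ⟨e.1, e.2⟩
  exact ⟨(isQuotientCoveringMap_mk_Cconf.fundamentalGroupEquiv ⟨e, he⟩).trans
    (MulEquiv.inv' _).symm⟩
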